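/- Let (φ_i)_{i ∈ ℕ} be an orthonormal (Hilbert) basis of L²(ℝⁿ). Then the family {c(d)^{−1/2} T_d(φ_i, φ_j) : i, j ∈ ℕ}, where c(d) = (2π)ⁿ / ∏_{j=1}^n d_j, is an orthonormal basis of L²(ℝ²ⁿ): it is an orthonormal system, and every f ∈ L²(ℝ²ⁿ) with ⟨f, T_d(φ_i, φ_j)⟩_{L²(ℝ²ⁿ)} = 0 for all i, j ∈ ℕ is zero almost everywhere. -/

import Mathlib

open MeasureTheory Complex

noncomputable section

/-- ℝⁿ with the Euclidean structure. -/
abbrev En (n : ℕ) := EuclideanSpace ℝ (Fin n)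

/-- The representation π_d(x,y) acting on functions:
`(π_d(x,y)φ)(ξ) = exp(i ∑_j d_j (x_j ξ_j + (1/2) x_j y_j)) φ(ξ + y)`. -/
def piD {n : ℕ} (d : Fin n → ℝ) (x y : En n) (φ : En n → ℂ) : En n → ℂ :=
  fun ξ =>
    Complex.exp (Complex.I *
      ((∑ j, d j * (x j * ξ j + (1 / 2) * (x j * y j)) : ℝ) : ℂ)) * φ (ξ + y)

/-- The Fourier–Wigner transform `T_d(φ,ψ)(x,y) = ⟨π_d(x,y)φ, ψ⟩`, with the
inner product `⟨u,v⟩ = ∫ u(ξ) conj(v(ξ)) dξ`. -/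
def Td {n : ℕ} (d : Fin n → ℝ) (φ ψ : En n → ℂ) (v : En n × En n) : ℂ :=
  ∫ ξ : En n, piD d v.1 v.2 φ ξ * (starRingEnd ℂ) (ψ ξ)



open FourierTransform SchwartzMap in
theorem fourier_L1L2_ae {n : ℕ} (g : En n → ℂ) (h1 : Integrable g) (h2 : MemLp g 2 volume) :
    ((𝓕 (h2.toLp g) : Lp ℂ 2 (volume : Measure (En n))) : En n → ℂ) =ᵐ[volume] 𝓕 g := by
  have hcont : Continuous (𝓕 g) := by
    have := VectorFourier.fourierIntegral_continuous (μ := (volume : Measure (En n)))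
      (e := Real.fourierChar) (L := innerₗ (En n)) Real.continuous_fourierChar
      continuous_inner h1
    exact this
  apply ae_eq_of_integral_contDiff_smul_eq
  · exact (Lp.memLp _).locallyIntegrable (by norm_num)
  · exact hcont.locallyIntegrable
  intro u hu hus
  have hu' : ContDiff ℝ ((⊤ : ℕ∞) : WithTop ℕ∞) (fun x => (u x : ℂ)) := Complex.ofRealCLM.contDiff.comp hu
  have hus' : HasCompactSupport (fun x => (u x : ℂ)) := hus.comp_left (g := fun r : ℝ => (r : ℂ)) (by simp)
  let s : 𝓢(En n, ℂ) := hus'.toSchwartzMap hu'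
  have hs : ∀ x, s x = (u x : ℂ) := fun x => rfl
  have key := congrArg (fun T => T s) (Lp.fourier_toTemperedDistribution_eq (h2.toLp g))
  simp only [TemperedDistribution.fourier_apply, Lp.toTemperedDistribution_apply] at key
  have e1 : ∫ x, (𝓕 s) x • (h2.toLp g : En n → ℂ) x = ∫ x, (𝓕 s) x • g x := by
    apply integral_congr_ae
    filter_upwards [h2.coeFn_toLp] with x hx
    rw [hx]
  have e2 : ∫ x, (𝓕 s) x • g x = ∫ x, s x • 𝓕 g x := by
    have := VectorFourier.integral_fourierIntegral_smul_eq_flip (L := innerₗ (En n))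
      (μ := volume) (ν := volume) (e := Real.fourierChar) Real.continuous_fourierChar continuous_inner s.integrable h1
    simp only [flip_innerₗ] at this
    exact this
  rw [e1, e2] at key
  simpa [hs] using key.symm

open FourierTransform in
theorem plancherel_L1L2 {n : ℕ} (g g' : En n → ℂ) (h1 : Integrable g) (h2 : MemLp g 2 volume)
    (h1' : Integrable g') (h2' : MemLp g' 2 volume) :
    MemLp (𝓕 g) 2 volume ∧
    ∫ x, 𝓕 g x * (starRingEnd ℂ) (𝓕 g' x) = ∫ x, g x * (starRingEnd ℂ) (g' x) := by
  have a := fourier_L1L2_ae g h1 h2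
  have a' := fourier_L1L2_ae g' h1' h2'
  refine ⟨(memLp_congr_ae a).1 (Lp.memLp _), ?_⟩
  have := Lp.inner_fourier_eq (h2'.toLp g') (h2.toLp g)
  rw [L2.inner_def, L2.inner_def] at this
  calc _ = _ := integral_congr_ae (by
              filter_upwards [a, a'] with x hx hx'
              rw [← hx, ← hx']; rfl)
    _ = _ := this
    _ = _ := integral_congr_ae (by
              filter_upwards [h2.coeFn_toLp, h2'.coeFn_toLp] with x hx hx'
              rw [hx, hx']; rfl)

theorem shear_lemma {n : ℕ} (A B : En n → ℂ) (hA : Integrable A) (hB : Integrable B) :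
    Integrable (fun p : En n × En n => A (p.2 + p.1) * B p.2) (volume.prod volume) ∧
    ∫ p : En n × En n, A (p.2 + p.1) * B p.2 ∂(volume.prod volume) = (∫ x, A x) * ∫ x, B x := by
  have hmp := measurePreserving_prod_add_swap (volume : Measure (En n)) (volume : Measure (En n))
  have hi : Integrable (fun q : En n × En n => B q.1 * A q.2) (volume.prod volume) :=
    hB.mul_prod hA
  have hc := hmp.integrable_comp_of_integrable hi
  refine ⟨?_, ?_⟩
  · refine hc.congr (Filter.Eventually.of_forall fun p => ?_)
    simp [mul_comm]
  · have h1 : ∫ q : En n × En n, B q.1 * A q.2 ∂(volume.prod volume)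
        = ∫ p : En n × En n, B p.2 * A (p.2 + p.1) ∂(volume.prod volume) := by
      conv_lhs => rw [← hmp.map_eq]
      rw [integral_map hmp.aemeasurable]
      rw [hmp.map_eq]; exact hi.1
    rw [integral_prod_mul] at h1
    rw [mul_comm, h1]
    simp only [mul_comm]

/-- the frequency scaling map -/
def Dm {n : ℕ} (d : Fin n → ℝ) : En n →ₗ[ℝ] En n :=
  (Matrix.diagonal (fun j => -d j / (2 * Real.pi))).toLpLin 2 2

theorem Dm_apply {n : ℕ} (d : Fin n → ℝ) (x : En n) (j : Fin n) :
    Dm d x j = -d j / (2 * Real.pi) * x j := by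
  simp [Dm, Matrix.mulVec_diagonal]

theorem Dm_map {n : ℕ} (d : Fin n → ℝ) (hd : ∀ j, 0 < d j) :
    Measure.map (Dm d) (volume : Measure (En n)) =
      ENNReal.ofReal ((2 * Real.pi) ^ n / ∏ l, d l) • volume := by
  have hdet : LinearMap.det (Dm d) = ∏ j, (-d j / (2 * Real.pi)) := by
    rw [Dm, LinearMap.det_toLpLin, Matrix.det_diagonal]
  have hpi := Real.pi_pos
  have hne : LinearMap.det (Dm d) ≠ 0 := by
    rw [hdet, Finset.prod_ne_zero_iff]
    intro j _
    have := hd j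
    have : -d j ≠ 0 := by linarith
    positivity
  rw [Measure.map_linearMap_addHaar_eq_smul_addHaar _ hne, hdet]
  congr 2
  rw [abs_inv, Finset.abs_prod]
  have : ∀ j, |(-d j / (2 * Real.pi))| = d j / (2 * Real.pi) := fun j => by
    rw [abs_div, abs_neg, abs_of_pos (hd j), abs_of_pos (by positivity)]
  simp [this, Finset.prod_div_distrib]

theorem Dm_cont {n : ℕ} (d : Fin n → ℝ) : Continuous (Dm d : En n → En n) :=
  LinearMap.continuous_of_finiteDimensional _

theorem Dm_integral {n : ℕ} (d : Fin n → ℝ) (hd : ∀ j, 0 < d j) (h : En n → ℂ)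
    (hh : Integrable h) :
    Integrable (fun x => h (Dm d x)) ∧
    ∫ x, h (Dm d x) = (((2 * Real.pi) ^ n / ∏ l, d l : ℝ) : ℂ) * ∫ x, h x := by
  have hpos : 0 ≤ (2 * Real.pi) ^ n / ∏ l, d l :=
    div_nonneg (by positivity) (Finset.prod_nonneg fun j _ => (hd j).le)
  have hm : Integrable h (Measure.map (Dm d) volume) := by
    rw [Dm_map d hd]; exact hh.smul_measure ENNReal.ofReal_ne_top
  refine ⟨hm.comp_measurable (Dm_cont d).measurable, ?_⟩
  rw [← integral_map (Dm_cont d).aemeasurable hm.1, Dm_map d hd, integral_smul_measure,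
    ENNReal.toReal_ofReal hpos]
  simp

/-- cross term -/
def Fy {n : ℕ} (φ ψ : En n → ℂ) (y : En n) (ξ : En n) : ℂ := φ (ξ + y) * (starRingEnd ℂ) (ψ ξ)

open FourierTransform in
theorem Td_eq_fourier {n : ℕ} (d : Fin n → ℝ) (φ ψ : En n → ℂ) (x y : En n) :
    Td d φ ψ (x, y) = cexp (((∑ j, d j * ((1 / 2) * (x j * y j)) : ℝ) : ℂ) * I)
      * 𝓕 (Fy φ ψ y) (Dm d x) := by
  rw [Real.fourier_eq', ← integral_const_mul]
  unfold Td
  congr 1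
  ext ξ
  simp only [piD, Fy, smul_eq_mul]
  rw [← mul_assoc, ← mul_assoc, ← Complex.exp_add]
  congr 3
  rw [mul_comm I, ← add_mul, ← Complex.ofReal_add]
  congr 2
  rw [PiLp.inner_apply, Finset.mul_sum, ← Finset.sum_add_distrib]
  apply Finset.sum_congr rfl
  intro j _
  rw [Dm_apply]
  simp
  field_simp [Real.pi_ne_zero]
  ring

theorem Td_congr {n : ℕ} (d : Fin n → ℝ) {φ ψ φ' ψ' : En n → ℂ} (h : φ =ᵐ[volume] φ')
    (h' : ψ =ᵐ[volume] ψ') : Td d φ ψ = Td d φ' ψ' := by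
  ext v
  unfold Td
  apply integral_congr_ae
  have : (fun ξ => φ (ξ + v.2)) =ᵐ[volume] fun ξ => φ' (ξ + v.2) :=
    (measurePreserving_add_right volume v.2).quasiMeasurePreserving.ae_eq_comp h
  filter_upwards [this, h'] with ξ h1 h2
  simp only [piD]
  rw [h1, h2]

theorem Td_sm {n : ℕ} (d : Fin n → ℝ) {φ ψ : En n → ℂ} (h : StronglyMeasurable φ)
    (h' : StronglyMeasurable ψ) : StronglyMeasurable (Td d φ ψ) := by
  unfold Td
  apply StronglyMeasurable.integral_prod_right
    (f := fun v : En n × En n => fun ξ => piD d v.1 v.2 φ ξ * (starRingEnd ℂ) (ψ ξ))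
  apply Measurable.stronglyMeasurable
  have hφ := h.measurable
  have hψ := h'.measurable
  unfold Function.uncurry piD
  apply Measurable.mul
  · apply Measurable.mul
    · apply Continuous.measurable
      fun_prop
    · exact hφ.comp (by fun_prop)
  · exact (Complex.continuous_conj.measurable).comp (hψ.comp (by fun_prop))

theorem conj_memLp {α : Type*} [MeasurableSpace α] {μ : Measure α} {f : α → ℂ} (h : MemLp f 2 μ) :
    MemLp (fun x => (starRingEnd ℂ) (f x)) 2 μ :=
  h.star

theorem int_mul_conj {α : Type*} [MeasurableSpace α] {μ : Measure α} {f g : α → ℂ}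
    (h : MemLp f 2 μ) (h' : MemLp g 2 μ) :
    Integrable (fun x => f x * (starRingEnd ℂ) (g x)) μ :=
  h.integrable_mul (conj_memLp h')

theorem memLp_iff_conj {α : Type*} [MeasurableSpace α] {μ : Measure α} {f : α → ℂ}
    (hf : AEStronglyMeasurable f μ) :
    MemLp f 2 μ ↔ Integrable (fun x => f x * (starRingEnd ℂ) (f x)) μ := by
  refine ⟨fun h => int_mul_conj h h, fun h => ?_⟩
  rw [memLp_two_iff_integrable_sq_norm hf]
  refine h.norm.congr (Filter.Eventually.of_forall fun x => ?_)
  simp [sq]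

theorem Fy_integrable {n : ℕ} {φ ψ : En n → ℂ} (h : MemLp φ 2 volume) (h' : MemLp ψ 2 volume)
    (y : En n) : Integrable (Fy φ ψ y) :=
  int_mul_conj (f := fun ξ => φ (ξ + y))
    (h.comp_measurePreserving (measurePreserving_add_right volume y)) h'

theorem Fy_prod {n : ℕ} {φ ψ φ' ψ' : En n → ℂ} (h : MemLp φ 2 volume) (h' : MemLp ψ 2 volume)
    (k : MemLp φ' 2 volume) (k' : MemLp ψ' 2 volume) :
    Integrable (fun p : En n × En n => Fy φ ψ p.1 p.2 * (starRingEnd ℂ) (Fy φ' ψ' p.1 p.2))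
      (volume.prod volume) ∧
    ∫ p : En n × En n, Fy φ ψ p.1 p.2 * (starRingEnd ℂ) (Fy φ' ψ' p.1 p.2) ∂(volume.prod volume)
      = (∫ x, φ x * (starRingEnd ℂ) (φ' x)) * ∫ x, ψ' x * (starRingEnd ℂ) (ψ x) := by
  have := shear_lemma _ _ (int_mul_conj h k) (int_mul_conj k' h')
  have e : (fun p : En n × En n => Fy φ ψ p.1 p.2 * (starRingEnd ℂ) (Fy φ' ψ' p.1 p.2)) =
    fun p => φ (p.2 + p.1) * (starRingEnd ℂ) (φ' (p.2 + p.1)) *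
      (ψ' p.2 * (starRingEnd ℂ) (ψ p.2)) := by
    ext p
    simp only [Fy, map_mul, Complex.conj_conj]
    ring
  rw [e]
  exact this

theorem Fy_ae_memLp {n : ℕ} {φ ψ : En n → ℂ} (h : MemLp φ 2 volume) (h' : MemLp ψ 2 volume) :
    ∀ᵐ y : En n, MemLp (Fy φ ψ y) 2 volume := by
  have := (Fy_prod h h' h h').1.prod_right_ae
  filter_upwards [this] with y hy
  exact (memLp_iff_conj (Fy_integrable h h' y).1).2 hy

theorem Td_mul_conj {n : ℕ} (d : Fin n → ℝ) (φ ψ φ' ψ' : En n → ℂ) (x y : En n) :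
    Td d φ ψ (x, y) * (starRingEnd ℂ) (Td d φ' ψ' (x, y)) =
      FourierTransform.fourier (Fy φ ψ y) (Dm d x) *
        (starRingEnd ℂ) (FourierTransform.fourier (Fy φ' ψ' y) (Dm d x)) := by
  rw [Td_eq_fourier, Td_eq_fourier, map_mul]
  set a : ℝ := (∑ j, d j * ((1 / 2) * (x j * y j)) : ℝ)
  have : cexp (a * I) * (starRingEnd ℂ) (cexp (a * I)) = 1 := by
    rw [Complex.mul_conj, Complex.normSq_eq_norm_sq, Complex.norm_exp_ofReal_mul_I]; simp
  linear_combination (FourierTransform.fourier (Fy φ ψ y) (Dm d x) *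
        (starRingEnd ℂ) (FourierTransform.fourier (Fy φ' ψ' y) (Dm d x))) * this

theorem slice {n : ℕ} (d : Fin n → ℝ) (hd : ∀ j, 0 < d j) {φ ψ φ' ψ' : En n → ℂ}
    (h : MemLp φ 2 volume) (h' : MemLp ψ 2 volume)
    (k : MemLp φ' 2 volume) (k' : MemLp ψ' 2 volume) :
    ∀ᵐ y : En n, Integrable (fun x => Td d φ ψ (x, y) * (starRingEnd ℂ) (Td d φ' ψ' (x, y))) ∧
      ∫ x, Td d φ ψ (x, y) * (starRingEnd ℂ) (Td d φ' ψ' (x, y)) =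
      (((2 * Real.pi) ^ n / ∏ l, d l : ℝ) : ℂ) *
        ∫ ξ, Fy φ ψ y ξ * (starRingEnd ℂ) (Fy φ' ψ' y ξ) := by
  filter_upwards [Fy_ae_memLp h h', Fy_ae_memLp k k'] with y hy ky
  simp only [Td_mul_conj]
  have p := plancherel_L1L2 _ _ (Fy_integrable h h' y) hy (Fy_integrable k k' y) ky
  have p' := plancherel_L1L2 _ _ (Fy_integrable k k' y) ky (Fy_integrable k k' y) ky
  rw [← p.2]
  exact Dm_integral d hd (fun w => FourierTransform.fourier (Fy φ ψ y) w *
        (starRingEnd ℂ) (FourierTransform.fourier (Fy φ' ψ' y) w)) (int_mul_conj p.1 p'.1)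

theorem Td_aesm {n : ℕ} (d : Fin n → ℝ) {φ ψ : En n → ℂ}
    (h : MemLp φ 2 volume) (h' : MemLp ψ 2 volume) :
    StronglyMeasurable (Td d φ ψ) := by
  rw [Td_congr d h.1.ae_eq_mk h'.1.ae_eq_mk]
  exact Td_sm d h.1.stronglyMeasurable_mk h'.1.stronglyMeasurable_mk

theorem Td_memLp {n : ℕ} (d : Fin n → ℝ) (hd : ∀ j, 0 < d j) {φ ψ : En n → ℂ}
    (h : MemLp φ 2 volume) (h' : MemLp ψ 2 volume) :
    MemLp (Td d φ ψ) 2 (volume : Measure (En n × En n)) := by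
  have sm := Td_aesm d h h'
  rw [memLp_iff_conj sm.aestronglyMeasurable, Measure.volume_eq_prod, integrable_prod_iff']
  · have s := slice d hd h h' h h'
    refine ⟨s.mono fun y hy => hy.1, ?_⟩
    have e := (Fy_prod h h' h h').1.integral_prod_left.const_mul
      (((2 * Real.pi) ^ n / ∏ l, d l : ℝ) : ℂ)
    refine e.norm.congr ?_
    filter_upwards [s] with y hy
    rw [← hy.2]
    have e2 : ∀ x, Td d φ ψ (x, y) * (starRingEnd ℂ) (Td d φ ψ (x, y)) =
       ((‖Td d φ ψ (x, y) * (starRingEnd ℂ) (Td d φ ψ (x, y))‖ : ℝ) : ℂ) := by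
      intro x
      rw [norm_mul, RCLike.norm_conj, Complex.mul_conj, Complex.normSq_eq_norm_sq, sq]
    conv_lhs => rw [integral_congr_ae (Filter.Eventually.of_forall e2)]
    rw [integral_complex_ofReal, Complex.norm_real]
    exact abs_of_nonneg (integral_nonneg fun _ => norm_nonneg _)
  · exact (sm.mul (Complex.continuous_conj.comp_stronglyMeasurable sm)).aestronglyMeasurable

theorem Td_inner {n : ℕ} (d : Fin n → ℝ) (hd : ∀ j, 0 < d j) {φ ψ φ' ψ' : En n → ℂ}
    (h : MemLp φ 2 volume) (h' : MemLp ψ 2 volume)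
    (k : MemLp φ' 2 volume) (k' : MemLp ψ' 2 volume) :
    ∫ v : En n × En n, Td d φ ψ v * (starRingEnd ℂ) (Td d φ' ψ' v) =
      (((2 * Real.pi) ^ n / ∏ l, d l : ℝ) : ℂ) *
       ((∫ x, φ x * (starRingEnd ℂ) (φ' x)) * ∫ x, ψ' x * (starRingEnd ℂ) (ψ x)) := by
  have hi := int_mul_conj (Td_memLp d hd h h') (Td_memLp d hd k k')
  rw [Measure.volume_eq_prod] at hi ⊢
  rw [integral_prod_symm _ hi, ← (Fy_prod h h' k k').2, integral_prod _ (Fy_prod h h' k k').1,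
    ← integral_const_mul]
  exact integral_congr_ae ((slice d hd h h' k k').mono fun y hy => hy.2)

theorem ext_clm {n : ℕ} (φ : ℕ → (En n → ℂ))
    (hφL2 : ∀ i, MemLp (φ i) 2 (volume : Measure (En n)))
    (hcomplete : ∀ g : En n → ℂ, MemLp g 2 (volume : Measure (En n)) →
      (∀ i, (∫ ξ : En n, g ξ * (starRingEnd ℂ) (φ i ξ)) = 0) →
      g =ᵐ[volume] 0) (L : Lp ℂ 2 (volume : Measure (En n)) →L[ℂ] ℂ)
    (h0 : ∀ i, L ((hφL2 i).toLp (φ i)) = 0) : L = 0 := by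
  obtain ⟨u, rfl⟩ := (InnerProductSpace.toDual ℂ (Lp ℂ 2 (volume : Measure (En n)))).surjective L
  have hu : u = 0 := by
    rw [Lp.eq_zero_iff_ae_eq_zero]
    apply hcomplete _ (Lp.memLp u)
    intro i
    have := h0 i
    rw [InnerProductSpace.toDual_apply_apply, ← inner_conj_symm, map_eq_zero, L2.inner_def] at this
    rw [← this]
    apply integral_congr_ae
    filter_upwards [(hφL2 i).coeFn_toLp] with x hx
    rw [hx]; rfl
  rw [hu, map_zero]

theorem ext_slot {n : ℕ} (φ : ℕ → (En n → ℂ))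
    (hφL2 : ∀ i, MemLp (φ i) 2 (volume : Measure (En n)))
    (hcomplete : ∀ g : En n → ℂ, MemLp g 2 (volume : Measure (En n)) →
      (∀ i, (∫ ξ : En n, g ξ * (starRingEnd ℂ) (φ i ξ)) = 0) →
      g =ᵐ[volume] 0)
    (S : (En n → ℂ) → (En n × En n → ℂ))
    (hmem : ∀ g, MemLp g 2 (volume : Measure (En n)) → MemLp (S g) 2 volume)
    (hcongr : ∀ g g', g =ᵐ[(volume : Measure (En n))] g' → S g = S g')
    (hadd : ∀ g g', MemLp g 2 (volume : Measure (En n)) → MemLp g' 2 (volume : Measure (En n)) →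
      S (g + g') = S g + S g')
    (hsmul : ∀ (c : ℂ) (g), MemLp g 2 (volume : Measure (En n)) → S (c • g) = c • S g)
    (C : ℝ) (hC : 0 ≤ C)
    (hb : ∀ g, MemLp g 2 (volume : Measure (En n)) →
      ∫ v, S g v * (starRingEnd ℂ) (S g v) = (C : ℂ) * ∫ x, g x * (starRingEnd ℂ) (g x))
    (f : En n × En n → ℂ) (hf : MemLp f 2 volume)
    (h0 : ∀ i, ∫ v, f v * S (φ i) v = 0) (g : En n → ℂ) (hg : MemLp g 2 volume) :
    ∫ v, f v * S g v = 0 := by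
  have nrm : ∀ {α : Type} [MeasureSpace α] (k : α → ℂ) (hk : MemLp k 2 volume),
      ((‖hk.toLp k‖ ^ 2 : ℝ) : ℂ) = ∫ x, k x * (starRingEnd ℂ) (k x) := by
    intro α _ k hk
    have := inner_self_eq_norm_sq_to_K (𝕜 := ℂ) (hk.toLp k)
    push_cast
    rw [L2.inner_def] at this
    refine this.symm.trans ?_
    apply integral_congr_ae
    filter_upwards [hk.coeFn_toLp] with x hx
    rw [hx]; rfl
  let Sl : Lp ℂ 2 (volume : Measure (En n)) →ₗ[ℂ] Lp ℂ 2 (volume : Measure (En n × En n)) :=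
    { toFun := fun g => (hmem g (Lp.memLp g)).toLp (S g)
      map_add' := by
        intro a b
        rw [← MemLp.toLp_add]
        congr 1
        rw [← hadd _ _ (Lp.memLp a) (Lp.memLp b)]
        exact hcongr _ _ (Lp.coeFn_add a b)
      map_smul' := by
        intro c a
        rw [RingHom.id_apply, ← MemLp.toLp_const_smul]
        congr 1
        rw [← hsmul _ _ (Lp.memLp a)]
        exact hcongr _ _ (Lp.coeFn_smul c a) }
  have hSl : ∀ g, Sl g = (hmem g (Lp.memLp g)).toLp (S g) := fun _ => rfl
  let Sc := Sl.mkContinuous (Real.sqrt C) (by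
    intro a
    have h1 := nrm _ (hmem a (Lp.memLp a))
    rw [hb _ (Lp.memLp a), ← nrm _ (Lp.memLp a), Lp.toLp_coeFn, ← Complex.ofReal_mul,
      Complex.ofReal_inj] at h1
    rw [hSl]
    apply le_of_sq_le_sq _ (by positivity)
    rw [h1, mul_pow, Real.sq_sqrt hC])
  have hSc : ∀ g, Sc g = Sl g := fun _ => rfl
  let F : Lp ℂ 2 (volume : Measure (En n × En n)) := (conj_memLp hf).toLp _
  have hval : ∀ g (hg : MemLp g 2 (volume : Measure (En n))),
      (innerSL ℂ F ∘L Sc) (hg.toLp g) = ∫ v, f v * S g v := by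
    intro g hg
    rw [ContinuousLinearMap.comp_apply, innerSL_apply_apply, hSc, hSl, L2.inner_def]
    apply integral_congr_ae
    have e : S (hg.toLp g) = S g := hcongr _ _ hg.coeFn_toLp
    filter_upwards [(conj_memLp hf).coeFn_toLp,
      (hmem _ (Lp.memLp (hg.toLp g))).coeFn_toLp] with v h1 h2
    rw [h2, e]
    simp only [F]
    rw [h1]
    simp [mul_comm]
  have := ext_clm φ hφL2 hcomplete (innerSL ℂ F ∘L Sc) (fun i => by rw [hval, h0 i])
  rw [← hval g hg, this]
  simp

theorem piD_memLp {n : ℕ} (d : Fin n → ℝ) (x y : En n) {φ : En n → ℂ} (h : MemLp φ 2 volume) :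
    MemLp (piD d x y φ) 2 volume := by
  have h1 : MemLp (fun ξ => φ (ξ + y)) 2 volume :=
    h.comp_measurePreserving (measurePreserving_add_right volume y)
  refine h1.of_le ?_ (Filter.Eventually.of_forall fun ξ => ?_)
  · unfold piD
    refine AEStronglyMeasurable.mul ?_ h1.1
    apply Continuous.aestronglyMeasurable
    fun_prop
  · simp only [piD]
    rw [norm_mul, mul_comm I, Complex.norm_exp_ofReal_mul_I, one_mul]

theorem Td_add_left {n : ℕ} (d : Fin n → ℝ) {φ φ' ψ : En n → ℂ} (h : MemLp φ 2 volume)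
    (h' : MemLp φ' 2 volume) (k : MemLp ψ 2 volume) :
    Td d (φ + φ') ψ = Td d φ ψ + Td d φ' ψ := by
  ext v
  simp only [Td, Pi.add_apply]
  rw [← integral_add (int_mul_conj (piD_memLp d v.1 v.2 h) k)
    (int_mul_conj (piD_memLp d v.1 v.2 h') k)]
  congr 1; ext ξ
  simp only [piD, Pi.add_apply]; ring

theorem Td_add_right {n : ℕ} (d : Fin n → ℝ) {φ ψ' ψ : En n → ℂ} (h : MemLp φ 2 volume)
    (h' : MemLp ψ' 2 volume) (k : MemLp ψ 2 volume) :
    Td d φ (ψ + ψ') = Td d φ ψ + Td d φ ψ' := by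
  ext v
  simp only [Td, Pi.add_apply]
  rw [← integral_add (int_mul_conj (piD_memLp d v.1 v.2 h) k)
    (int_mul_conj (piD_memLp d v.1 v.2 h) h')]
  congr 1; ext ξ
  simp only [map_add]; ring

theorem Td_smul_left {n : ℕ} (d : Fin n → ℝ) (c : ℂ) (φ ψ : En n → ℂ) :
    Td d (c • φ) ψ = c • Td d φ ψ := by
  ext v
  simp only [Td, Pi.smul_apply, smul_eq_mul]
  rw [← integral_const_mul]
  congr 1; ext ξ
  simp only [piD, Pi.smul_apply, smul_eq_mul]; ring

theorem Td_smul_right {n : ℕ} (d : Fin n → ℝ) (c : ℂ) (φ ψ : En n → ℂ) :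
    Td d φ (c • ψ) = (starRingEnd ℂ c) • Td d φ ψ := by
  ext v
  simp only [Td, Pi.smul_apply, smul_eq_mul]
  rw [← integral_const_mul]
  congr 1; ext ξ
  simp only [map_mul]; ring

theorem all_zero {n : ℕ} (d : Fin n → ℝ) (hd : ∀ j, 0 < d j)
    (φ : ℕ → (En n → ℂ))
    (hφL2 : ∀ i, MemLp (φ i) 2 (volume : Measure (En n)))
    (hcomplete : ∀ g : En n → ℂ, MemLp g 2 (volume : Measure (En n)) →
      (∀ i, (∫ ξ : En n, g ξ * (starRingEnd ℂ) (φ i ξ)) = 0) →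
      g =ᵐ[volume] 0)
    (f : En n × En n → ℂ) (hf : MemLp f 2 (volume : Measure (En n × En n)))
    (h0 : ∀ i j, (∫ v : En n × En n, f v * (starRingEnd ℂ) (Td d (φ i) (φ j) v)) = 0)
    (g g' : En n → ℂ) (hg : MemLp g 2 volume) (hg' : MemLp g' 2 volume) :
    ∫ v : En n × En n, f v * (starRingEnd ℂ) (Td d g g' v) = 0 := by
  have hpos : 0 ≤ (2 * Real.pi) ^ n / ∏ l, d l :=
    div_nonneg (by positivity) (Finset.prod_nonneg fun j _ => (hd j).le)
  have hsq : ∀ k : En n → ℂ,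
      ∫ x, k x * (starRingEnd ℂ) (k x) = ((∫ x, ‖k x‖ ^ 2 : ℝ) : ℂ) := by
    intro k
    rw [← integral_complex_ofReal]
    congr 1; ext x
    rw [Complex.mul_conj, Complex.normSq_eq_norm_sq]
  have hnn : ∀ k : En n → ℂ, 0 ≤ ∫ x, ‖k x‖ ^ 2 := fun k => integral_nonneg fun x => by positivity
  have step1 : ∀ i, ∀ ψ, MemLp ψ 2 (volume : Measure (En n)) →
      ∫ v : En n × En n, f v * (starRingEnd ℂ) (Td d (φ i) ψ v) = 0 := by
    intro i ψ hψ
    refine ext_slot φ hφL2 hcomplete (fun ψ v => (starRingEnd ℂ) (Td d (φ i) ψ v))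
      (fun g hg => conj_memLp (Td_memLp d hd (hφL2 i) hg)) ?_ ?_ ?_
      ((2 * Real.pi) ^ n / (∏ l, d l) * ∫ x, ‖φ i x‖ ^ 2) (mul_nonneg hpos (hnn _)) ?_ f hf
      (h0 i) ψ hψ
    · intro a b hab
      simp only [Td_congr d (Filter.EventuallyEq.refl _ (φ i)) hab]
    · intro a b ha hb
      ext v
      simp [Td_add_right d (hφL2 i) hb ha]
    · intro c a ha
      ext v
      simp [Td_smul_right]
    · intro a ha
      have := Td_inner d hd (hφL2 i) ha (hφL2 i) ha
      simp only [Complex.conj_conj]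
      simp only [mul_comm ((starRingEnd ℂ) (Td d _ _ _))]
      rw [this, hsq]
      push_cast; ring
  have step2 : ∫ v : En n × En n, (starRingEnd ℂ) (f v) * Td d g g' v = 0 := by
    refine ext_slot φ hφL2 hcomplete (fun φ => Td d φ g')
      (fun g hg => Td_memLp d hd hg hg') ?_ ?_ ?_
      ((2 * Real.pi) ^ n / (∏ l, d l) * ∫ x, ‖g' x‖ ^ 2) (mul_nonneg hpos (hnn _)) ?_ _
      (conj_memLp hf) ?_ g hg
    · intro a b hab
      simp only [Td_congr d hab (Filter.EventuallyEq.refl _ g')]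
    · intro a b ha hb
      exact Td_add_left d ha hb hg'
    · intro c a ha
      exact Td_smul_left d c a g'
    · intro a ha
      rw [Td_inner d hd ha hg' ha hg', hsq g']
      push_cast; ring
    · intro i
      have := congrArg (starRingEnd ℂ) (step1 i g' hg')
      rw [← integral_conj] at this
      simpa using this
  have := congrArg (starRingEnd ℂ) step2
  rw [← integral_conj] at this
  simpa using this

/-- symplectic form -/
def symL {n : ℕ} (d : Fin n → ℝ) : (En n × En n) →ₗ[ℝ] (En n × En n) →ₗ[ℝ] ℝ :=
  LinearMap.mk₂ ℝ (fun v w => ∑ j, d j * (w.1 j * v.2 j - v.1 j * w.2 j))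
    (by intro a b c; rw [← Finset.sum_add_distrib]; congr 1; ext j; simp; ring)
    (by intro a b c; rw [smul_eq_mul, Finset.mul_sum]; congr 1; ext j; simp; ring)
    (by intro a b c; rw [← Finset.sum_add_distrib]; congr 1; ext j; simp; ring)
    (by intro a b c; rw [smul_eq_mul, Finset.mul_sum]; congr 1; ext j; simp; ring)

theorem symL_apply {n : ℕ} (d : Fin n → ℝ) (v w : En n × En n) :
    symL d v w = ∑ j, d j * (w.1 j * v.2 j - v.1 j * w.2 j) := rfl

theorem symL_cont {n : ℕ} (d : Fin n → ℝ) :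
    Continuous fun p : (En n × En n) × (En n × En n) => symL d p.1 p.2 := by
  simp only [symL_apply]
  fun_prop

theorem symL_ne {n : ℕ} (d : Fin n → ℝ) (hd : ∀ j, 0 < d j) (v : En n × En n) (hv : v ≠ 0) :
    symL d v ≠ 0 := by
  intro h
  apply hv
  have h1 := congrArg (fun T => T (v.2, -v.1)) h
  simp only [symL_apply, LinearMap.zero_apply] at h1
  have h2 : ∑ j, d j * (v.2 j ^ 2 + v.1 j ^ 2) = 0 := by
    rw [← h1]; congr 1; ext j; simp only [PiLp.neg_apply]; ring
  rw [Finset.sum_eq_zero_iff_of_nonneg (fun j _ => mul_nonneg (hd j).le (by positivity))] at h2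
  have h3 : ∀ j, v.2 j = 0 ∧ v.1 j = 0 := by
    intro j
    have := h2 j (Finset.mem_univ j)
    have := (mul_eq_zero.1 this).resolve_left (hd j).ne'
    constructor <;> nlinarith [sq_nonneg (v.2 j), sq_nonneg (v.1 j)]
  ext j
  · simpa using (h3 j).2
  · simpa using (h3 j).1

theorem char_int {n : ℕ} (d : Fin n → ℝ) (w : En n × En n) {h : En n × En n → ℂ}
    (hh : Integrable h) : Integrable fun v => cexp (symL d v w * I) * h v := by
  refine hh.bdd_mul (c := 1) ?_ (Filter.Eventually.of_forall fun v => ?_)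
  · apply Continuous.aestronglyMeasurable
    simp only [symL_apply]
    fun_prop
  · rw [Complex.norm_exp_ofReal_mul_I]

theorem real_inj {n : ℕ} (d : Fin n → ℝ) (hd : ∀ j, 0 < d j) (r : En n × En n → ℝ)
    (hr : Integrable r) (h0 : ∀ w, ∫ v, cexp (symL d v w * I) * (r v : ℂ) = 0) :
    r =ᵐ[volume] 0 := by
  have := isFiniteMeasure_withDensity_ofReal hr.2
  have := isFiniteMeasure_withDensity_ofReal hr.neg.2
  have key : (volume : Measure (En n × En n)).withDensity (fun x => ENNReal.ofReal (r x)) =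
      (volume : Measure (En n × En n)).withDensity (fun x => ENNReal.ofReal ((-r) x)) := by
    refine ext_of_integral_char_eq Real.continuous_probChar Real.probChar_ne_one
      (symL_ne d hd) (symL_cont d) fun w => ?_
    simp only [BoundedContinuousFunction.char_apply, Real.probChar_apply]
    have e1 := integral_withDensity_eq_integral_smul₀ (μ := volume) hr.1.aemeasurable.real_toNNReal
      (fun v => cexp (symL d v w * I))
    have e2 := integral_withDensity_eq_integral_smul₀ (μ := volume)
      hr.neg.1.aemeasurable.real_toNNReal (fun v => cexp (symL d v w * I))
    refine e1.trans (Eq.trans ?_ e2.symm)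
    rw [← sub_eq_zero, ← integral_sub, ← h0 w]
    · congr 1
      ext v
      have : (r v : ℂ) = ((max (r v) 0 - max (-r v) 0 : ℝ) : ℂ) := by
        congr 1
        rcases le_total 0 (r v) with h | h
        · rw [max_eq_left h, max_eq_right (by linarith)]; simp
        · rw [max_eq_right h, max_eq_left (by linarith)]; simp
      rw [this]
      simp only [NNReal.smul_def, Real.coe_toNNReal', Complex.real_smul, Pi.neg_apply]
      push_cast; ring
    · have := char_int d w (h := fun v => ((max (r v) 0 : ℝ) : ℂ)) hr.pos_part.ofReal
      refine this.congr (Filter.Eventually.of_forall fun v => ?_)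
      simp [NNReal.smul_def, Real.coe_toNNReal', Complex.real_smul, mul_comm]
    · have := char_int d w (h := fun v => ((max (-r v) 0 : ℝ) : ℂ)) hr.neg.pos_part.ofReal
      refine this.congr (Filter.Eventually.of_forall fun v => ?_)
      simp [NNReal.smul_def, Real.coe_toNNReal', Complex.real_smul, mul_comm]
  rw [withDensity_eq_iff_of_sigmaFinite hr.1.aemeasurable.ennreal_ofReal
    hr.neg.1.aemeasurable.ennreal_ofReal] at key
  filter_upwards [key] with v hv
  simp only [Pi.neg_apply] at hv
  rcases lt_trichotomy (r v) 0 with h | h | h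
  · rw [ENNReal.ofReal_of_nonpos h.le] at hv
    have := ENNReal.ofReal_eq_zero.1 hv.symm
    linarith
  · exact h
  · rw [ENNReal.ofReal_of_nonpos (p := -r v) (by linarith)] at hv
    have := ENNReal.ofReal_eq_zero.1 hv
    linarith

theorem cplx_inj {n : ℕ} (d : Fin n → ℝ) (hd : ∀ j, 0 < d j) (h : En n × En n → ℂ)
    (hh : Integrable h) (h0 : ∀ w, ∫ v, cexp (symL d v w * I) * h v = 0) :
    h =ᵐ[volume] 0 := by
  have hc : Integrable (fun v => (starRingEnd ℂ) (h v)) :=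
    (LinearIsometryEquiv.integrable_comp_iff Complex.conjLIE).2 hh
  have h1 : ∀ w, ∫ v, cexp (symL d v w * I) * (starRingEnd ℂ) (h v) = 0 := by
    intro w
    have := congrArg (starRingEnd ℂ) (h0 (-w))
    rw [← integral_conj] at this
    simp only [map_mul, ← Complex.exp_conj] at this
    simpa using this
  have hre := real_inj d hd (fun v => (h v).re) hh.re (fun w => by
    have := (integral_add (char_int d w hh) (char_int d w hc)).symm
    rw [h0, h1, add_zero] at this
    have e : ∀ v, cexp (symL d v w * I) * ((h v).re : ℂ) = (1/2 : ℂ) *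
      (cexp (symL d v w * I) * h v + cexp (symL d v w * I) * (starRingEnd ℂ) (h v)) := by
      intro v
      rw [Complex.re_eq_add_conj]; ring
    simp only [e]
    rw [integral_const_mul, ← this, mul_zero])
  have him := real_inj d hd (fun v => (h v).im) hh.im (fun w => by
    have := (integral_sub (char_int d w hh) (char_int d w hc)).symm
    rw [h0, h1, sub_zero] at this
    have e : ∀ v, cexp (symL d v w * I) * ((h v).im : ℂ) = (1/(2 * I) : ℂ) *
      (cexp (symL d v w * I) * h v - cexp (symL d v w * I) * (starRingEnd ℂ) (h v)) := by
      intro v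
      rw [Complex.im_eq_sub_conj]; ring
    simp only [e]
    rw [integral_const_mul, ← this, mul_zero])
  filter_upwards [hre, him] with v a b
  exact Complex.ext a b

theorem Td_cov {n : ℕ} (d : Fin n → ℝ) (φ ψ : En n → ℂ) (v w : En n × En n) :
    Td d (piD d w.1 w.2 φ) (piD d w.1 w.2 ψ) v = cexp (symL d v w * I) * Td d φ ψ v := by
  unfold Td
  rw [← integral_const_mul]
  conv_rhs => rw [← integral_add_right_eq_self _ w.2]
  congr 1; ext ξ
  simp only [piD, map_mul, ← Complex.exp_conj, Complex.conj_I, Complex.conj_ofReal]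
  rw [show ξ + v.2 + w.2 = ξ + w.2 + v.2 by abel]
  have : ∀ a b c e f p q : ℂ, cexp a * cexp b * cexp c = cexp e * cexp f →
    cexp a * (cexp b * p) * (cexp c * q) = cexp e * (cexp f * p * q) := by
    intro a b c e f p q h
    linear_combination (p * q) * h
  apply this
  rw [← Complex.exp_add, ← Complex.exp_add, ← Complex.exp_add]
  congr 1
  rw [symL_apply, mul_comm _ I, neg_mul, ← sub_eq_add_neg, ← mul_add, ← mul_sub, ← mul_add]
  congr 1
  norm_cast
  rw [← Finset.sum_add_distrib, ← Finset.sum_sub_distrib, ← Finset.sum_add_distrib]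
  congr 1; ext j
  simp
  ring

/-- Gaussian -/
def gau {n : ℕ} (ξ : En n) : ℂ := cexp (-(1 / 2 : ℂ) * ‖ξ‖ ^ 2)

theorem gau_conj {n : ℕ} (ξ : En n) : (starRingEnd ℂ) (gau ξ) = gau ξ := by
  have : (starRingEnd ℂ) 2 = 2 := map_ofNat _ 2
  simp [gau, ← Complex.exp_conj, this]

theorem gau_memLp {n : ℕ} : MemLp (gau : En n → ℂ) 2 volume := by
  have hc : Continuous (gau : En n → ℂ) := by unfold gau; fun_prop
  rw [memLp_iff_conj hc.aestronglyMeasurable]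
  have := GaussianFourier.integrable_cexp_neg_mul_sq_norm_add (V := En n) (b := 1) (by simp) 0 0
  refine this.congr (Filter.Eventually.of_forall fun ξ => ?_)
  simp only [gau_conj]
  simp only [gau, ← Complex.exp_add]
  congr 1
  simp; ring

theorem gau_Td {n : ℕ} (d : Fin n → ℝ) (v : En n × En n) : Td d gau gau v ≠ 0 := by
  let w : En n := WithLp.toLp 2 (fun j => d j * v.1 j)
  have e : Td d gau gau v = cexp (-(1 / 4 : ℂ) * ‖v.2‖ ^ 2) *
      ∫ ξ : En n, cexp (-1 * ‖ξ‖ ^ 2 + I * (inner ℝ w ξ : ℝ)) := by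
    unfold Td
    rw [← integral_const_mul, ← integral_sub_right_eq_self _ ((1 / 2 : ℝ) • v.2)]
    congr 1; ext ξ
    rw [gau_conj]
    simp only [piD, gau]
    rw [← Complex.exp_add, ← Complex.exp_add, ← Complex.exp_add]
    congr 1
    have n1 : ‖ξ - (1 / 2 : ℝ) • v.2 + v.2‖ ^ 2 + ‖ξ - (1 / 2 : ℝ) • v.2‖ ^ 2 =
        2 * ‖ξ‖ ^ 2 + 1 / 2 * ‖v.2‖ ^ 2 := by
      rw [show ξ - (1 / 2 : ℝ) • v.2 + v.2 = ξ + (1 / 2 : ℝ) • v.2 by module]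
      have := parallelogram_law_with_norm ℝ ξ ((1 / 2 : ℝ) • v.2)
      rw [norm_smul] at this
      norm_num at this
      linarith
    have n2 : inner ℝ w ξ = ∑ j, d j * (v.1 j * (ξ - (1 / 2 : ℝ) • v.2) j
        + (1 / 2) * (v.1 j * v.2 j)) := by
      rw [PiLp.inner_apply]
      congr 1; ext j
      simp [w]; ring
    rw [← n2]
    have n3 := congrArg (fun r : ℝ => (r : ℂ)) n1
    push_cast at n3
    linear_combination (-(1 / 2 : ℂ)) * n3
  rw [e, GaussianFourier.integral_cexp_neg_mul_sq_norm_add (by simp)]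
  refine mul_ne_zero (Complex.exp_ne_zero _) (mul_ne_zero ?_ (Complex.exp_ne_zero _))
  rw [Complex.cpow_def_of_ne_zero (by simp [Real.pi_ne_zero])]
  exact Complex.exp_ne_zero _

/-- Let (φ_i)_{i∈ℕ} be an orthonormal basis of L²(ℝⁿ). Then the family
{c(d)^{−1/2} T_d(φ_i, φ_j) : i, j ∈ ℕ}, with c(d) = (2π)ⁿ / ∏_j d_j, is an orthonormal
basis of L²(ℝ²ⁿ): it is an orthonormal system, and every f ∈ L²(ℝ²ⁿ) with
⟨f, T_d(φ_i,φ_j)⟩ = 0 for all i, j is zero almost everywhere. -/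
theorem stmt14 {n : ℕ} (hn : 1 ≤ n) (d : Fin n → ℝ) (hd : ∀ j, 0 < d j)
    (φ : ℕ → (En n → ℂ))
    (hφL2 : ∀ i, MemLp (φ i) 2 (volume : Measure (En n)))
    (hortho : ∀ i j, (∫ ξ : En n, φ i ξ * (starRingEnd ℂ) (φ j ξ)) =
      if i = j then 1 else 0)
    (hcomplete : ∀ g : En n → ℂ, MemLp g 2 (volume : Measure (En n)) →
      (∀ i, (∫ ξ : En n, g ξ * (starRingEnd ℂ) (φ i ξ)) = 0) →
      g =ᵐ[volume] 0) :
    (∀ i j i' j' : ℕ,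
      (∫ v : En n × En n,
        (((Real.sqrt ((2 * Real.pi) ^ n / ∏ l, d l))⁻¹ : ℝ) : ℂ) * Td d (φ i) (φ j) v *
        (starRingEnd ℂ)
          ((((Real.sqrt ((2 * Real.pi) ^ n / ∏ l, d l))⁻¹ : ℝ) : ℂ) * Td d (φ i') (φ j') v)) =
        if i = i' ∧ j = j' then 1 else 0) ∧
    (∀ f : En n × En n → ℂ, MemLp f 2 (volume : Measure (En n × En n)) →
      (∀ i j, (∫ v : En n × En n, f v * (starRingEnd ℂ) (Td d (φ i) (φ j) v)) = 0) →
      f =ᵐ[volume] 0) := by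
  constructor
  · intro i j i' j'
    have hpos : 0 < (2 * Real.pi) ^ n / ∏ l, d l :=
      div_pos (by positivity) (Finset.prod_pos fun j _ => hd j)
    have h := Td_inner d hd (hφL2 i) (hφL2 j) (hφL2 i') (hφL2 j')
    rw [hortho, hortho] at h
    set c : ℝ := (2 * Real.pi) ^ n / ∏ l, d l with hc
    have e : ∀ v, (((Real.sqrt c)⁻¹ : ℝ) : ℂ) * Td d (φ i) (φ j) v *
        (starRingEnd ℂ) ((((Real.sqrt c)⁻¹ : ℝ) : ℂ) * Td d (φ i') (φ j') v) =
        ((c⁻¹ : ℝ) : ℂ) * (Td d (φ i) (φ j) v * (starRingEnd ℂ) (Td d (φ i') (φ j') v)) := by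
      intro v
      have : ((c⁻¹ : ℝ) : ℂ) = (((Real.sqrt c)⁻¹ : ℝ) : ℂ) * (((Real.sqrt c)⁻¹ : ℝ) : ℂ) := by
        rw [← Complex.ofReal_mul, ← mul_inv, Real.mul_self_sqrt hpos.le]
      rw [map_mul, Complex.conj_ofReal, this]
      ring
    simp only [e]
    rw [integral_const_mul, h, ← mul_assoc, ← Complex.ofReal_mul, inv_mul_cancel₀ hpos.ne',
      Complex.ofReal_one, one_mul]
    by_cases h1 : i = i' <;> by_cases h2 : j = j' <;> simp [h1, h2, eq_comm]
  · intro f hf h0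
    have hG := Td_memLp d hd (gau_memLp (n := n)) (gau_memLp (n := n))
    have hz := cplx_inj d hd _ (int_mul_conj hf hG) (fun w => by
      have := all_zero d hd φ hφL2 hcomplete f hf h0 _ _ (piD_memLp d (-w).1 (-w).2 gau_memLp)
        (piD_memLp d (-w).1 (-w).2 gau_memLp)
      simp only [Td_cov d gau gau _ (-w)] at this
      rw [← this]
      congr 1; ext v
      rw [map_mul, ← Complex.exp_conj]
      simp
      ring)
    filter_upwards [hz] with v hv
    have h1 := (mul_eq_zero.1 hv).resolve_right
    exact h1 (by simpa using gau_Td d v)
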